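/- There exists N ∈ ℕ, depending only on B and w₁, …, w_r, such that every continuous function σ : D → ℤ can be written as a finite ℤ-linear combination of continuous functions D → ℤ, each of which is supported on some finite nonempty subtree of T with at most N vertices. -/

import Mathlib

open scoped BigOperators

namespace DecompPaper

variable (B : Type) [DecidableEq B]

/-- The set of letters `B ⊔ B⁻¹` carries the discrete topology. -/
instance : TopologicalSpace (B × Bool) := ⊥

/-- The Gromov boundary `∂F` of the free group on `B`: the space of infinite reduced
words, i.e. sequences of letters with no cancelling adjacent pair, topologized as a
subspace of the product of discrete spaces. -/
abbrev Boundary : Type :=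
  {s : ℕ → B × Bool // ∀ k, s (k + 1) ≠ ((s k).1, !(s k).2)}

/-- The prefix of length `m` of an infinite reduced word, as an element of the free group. -/
def prefixOf (ξ : Boundary B) (m : ℕ) : FreeGroup B :=
  FreeGroup.mk (List.ofFn fun i : Fin m => ξ.1 i)

/-- Adjacency in the Cayley graph `T` of the free group with respect to `B`. -/
def Adj (g h : FreeGroup B) : Prop :=
  ∃ x : B × Bool, h = g * FreeGroup.mk [x]

/-- A set of vertices of `T` is a subtree iff any two of its vertices are joined by a
path in the Cayley graph staying inside the set. -/
def IsSubtree (X : Set (FreeGroup B)) : Prop :=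
  ∀ g ∈ X, ∀ h ∈ X, Relation.ReflTransGen (fun a b => Adj B a b ∧ b ∈ X) g h

/-- `C` is a connected component of `T ∖ X`. -/
def IsComponentOf (X C : Set (FreeGroup B)) : Prop :=
  ∃ v, v ∉ X ∧
    C = {u | Relation.ReflTransGen (fun a b => Adj B a b ∧ a ∉ X ∧ b ∉ X) v u}

/-- `∂C`: the set of boundary points all of whose sufficiently long prefixes lie in `C`. -/
def boundaryOf (C : Set (FreeGroup B)) : Set (Boundary B) :=
  {ξ | ∃ m, ∀ k, m ≤ k → prefixOf B ξ k ∈ C}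

/-- The sequence `a` of group elements converges to the boundary point `ξ`:
every prefix of `ξ` is eventually an initial segment of the reduced word of `a k`. -/
def TendstoBoundary (a : ℕ → FreeGroup B) (ξ : Boundary B) : Prop :=
  ∀ m : ℕ, ∃ K, ∀ k, K ≤ k → (List.ofFn fun i : Fin m => ξ.1 i) <+: (a k).toWord

/-- `{ξ, η}` is a line of the line pattern generated by the words `w i`: for some
`g` and `i`, `ξ` and `η` are the limits of `g * (w i) ^ k` as `k → +∞` and `k → -∞`
(in one of the two orders). -/
def IsLine {r : ℕ} (w : Fin r → FreeGroup B) (ξ η : Boundary B) : Prop :=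
  ∃ (g : FreeGroup B) (i : Fin r),
    (TendstoBoundary B (fun k => g * w i ^ k) ξ ∧
       TendstoBoundary B (fun k => g * (w i)⁻¹ ^ k) η) ∨
    (TendstoBoundary B (fun k => g * w i ^ k) η ∧
       TendstoBoundary B (fun k => g * (w i)⁻¹ ^ k) ξ)

/-- Malnormality of the family of cyclic subgroups `⟨w i⟩`. -/
def Malnormal {r : ℕ} (w : Fin r → FreeGroup B) : Prop :=
  ∀ (g : FreeGroup B) (i j : Fin r),
    (∃ x : FreeGroup B, x ∈ Subgroup.zpowers (w i) ∧ x ≠ 1 ∧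
        g * x * g⁻¹ ∈ Subgroup.zpowers (w j)) →
      i = j ∧ g ∈ Subgroup.zpowers (w i)

/-- The decomposition space `D`: the quotient of `∂F` by the smallest equivalence
relation identifying the two endpoints of each line, with the quotient topology. -/
abbrev DSpace {r : ℕ} (w : Fin r → FreeGroup B) : Type :=
  Quot (IsLine B w)

/-- The quotient projection `q : ∂F → D`. -/
def qmap {r : ℕ} (w : Fin r → FreeGroup B) : Boundary B → DSpace B w :=
  Quot.mk _

/-- The geodesic of the line with endpoints `ξ` and `η`: all prefixes of `ξ` or of `η`
of length at least the length of their longest common initial segment. -/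
def lineGeodesic (ξ η : Boundary B) : Set (FreeGroup B) :=
  {g | ∃ k : ℕ, (g = prefixOf B ξ k ∨ g = prefixOf B η k) ∧ ∃ i ≤ k, ξ.1 i ≠ η.1 i}

/-- The line with endpoints `ξ, η` passes through the subtree `X`. -/
def PassesThrough (ξ η : Boundary B) (X : Set (FreeGroup B)) : Prop :=
  ∃ g ∈ X, g ∈ lineGeodesic B ξ η

/-- A function `σ : D → ℤ` is supported on the subtree `X` if `σ ∘ q` is constant on
`∂C` for every connected component `C` of `T ∖ X`. -/
def SupportedOn {r : ℕ} (w : Fin r → FreeGroup B) (σ : DSpace B w → ℤ)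
    (X : Set (FreeGroup B)) : Prop :=
  ∀ C : Set (FreeGroup B), IsComponentOf B X C →
    ∀ ξ, ξ ∈ boundaryOf B C → ∀ η, η ∈ boundaryOf B C →
      σ (qmap B w ξ) = σ (qmap B w η)

/-- Prepending a letter to an infinite reduced word, cancelling if necessary. -/
def consB (x : B × Bool) (ξ : Boundary B) : Boundary B :=
  if h : ξ.1 0 = (x.1, !x.2) then
    ⟨fun k => ξ.1 (k + 1), fun k => ξ.2 (k + 1)⟩
  else
    ⟨fun k => Nat.rec x (fun j _ => ξ.1 j) k, by
      intro k
      cases k with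
      | zero => exact h
      | succ j => exact ξ.2 j⟩

/-- The action of the free group on its boundary: left multiplication followed by
reduction. -/
def actB (g : FreeGroup B) (ξ : Boundary B) : Boundary B :=
  g.toWord.foldr (consB B) ξ

/-- The induced action of the free group on the decomposition space. -/
noncomputable def actD {r : ℕ} (w : Fin r → FreeGroup B) (g : FreeGroup B)
    (x : DSpace B w) : DSpace B w :=
  qmap B w (actB B g (Quot.out x))

/-- The map `p : (ℤ[F])^k → C(D, ℤ)` of right `ℤ[F]`-modules determined by generators
`σ j`, where an element of the free module `(ℤ[F])^k` is recorded as a finitely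
supported function `(Fin k × F) →₀ ℤ` and `e_j · g` is sent to `σ j · g`. -/
noncomputable def pMap {r : ℕ} (w : Fin r → FreeGroup B) {k : ℕ}
    (σ : Fin k → DSpace B w → ℤ) (x : (Fin k × FreeGroup B) →₀ ℤ) :
    DSpace B w → ℤ :=
  fun d => x.sum fun p n => n * σ p.1 (actD B w p.2 d)

/-- Right translation by `g` on the free module `(ℤ[F])^k`, sending `e_j · h` to
`e_j · (h * g)`. -/
noncomputable def fsTranslate {k : ℕ} (y : (Fin k × FreeGroup B) →₀ ℤ)
    (g : FreeGroup B) : (Fin k × FreeGroup B) →₀ ℤ :=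
  Finsupp.mapDomain (fun p => (p.1, p.2 * g)) y

/-- The convex hull of a set of vertices of `T`: the smallest subtree containing it. -/
def hull (S : Set (FreeGroup B)) : Set (FreeGroup B) :=
  ⋂₀ {Y : Set (FreeGroup B) | IsSubtree B Y ∧ S ⊆ Y}

/-- The support of an element of the free module `(ℤ[F])^k`, relative to supports
`X j` of the generators: the convex hull of the union of the sets `g⁻¹ • X j` over
the pairs `(j, g)` appearing with nonzero coefficient. -/
def fsSupport {k : ℕ} (X : Fin k → Set (FreeGroup B))
    (x : (Fin k × FreeGroup B) →₀ ℤ) : Set (FreeGroup B) :=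
  hull B (⋃ p ∈ x.support, (fun v => p.2⁻¹ * v) '' X p.1)

/-- Antisymmetry of a `1`-cochain on oriented lines. -/
def Antisym {r : ℕ} (w : Fin r → FreeGroup B)
    (f : Boundary B → Boundary B → ℤ) : Prop :=
  ∀ ξ η, IsLine B w ξ η → f η ξ = -f ξ η

/-- A `1`-cochain is supported on the subtree `X`: it vanishes on lines not passing
through `X`, and depends only on the pair of components of `T ∖ X` containing the two
endpoints. -/
def SupportedOn1 {r : ℕ} (w : Fin r → FreeGroup B)
    (f : Boundary B → Boundary B → ℤ) (X : Set (FreeGroup B)) : Prop :=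
  (∀ ξ η, IsLine B w ξ η → ¬PassesThrough B ξ η X → f ξ η = 0) ∧
  (∀ C C' : Set (FreeGroup B), IsComponentOf B X C → IsComponentOf B X C' → C ≠ C' →
    ∀ ξ ξ' η η', IsLine B w ξ η → IsLine B w ξ' η' →
      ξ ∈ boundaryOf B C → ξ' ∈ boundaryOf B C →
      η ∈ boundaryOf B C' → η' ∈ boundaryOf B C' →
      f ξ η = f ξ' η')

/-- Membership in `C¹`: an antisymmetric integer-valued function on oriented lines
supported on at least one finite nonempty subtree of `T`. -/
def MemC1 {r : ℕ} (w : Fin r → FreeGroup B)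
    (f : Boundary B → Boundary B → ℤ) : Prop :=
  Antisym B w f ∧
    ∃ X : Set (FreeGroup B), X.Finite ∧ X.Nonempty ∧ IsSubtree B X ∧
      SupportedOn1 B w f X

/-- The ball of radius `R` about a set `Y` of vertices of `T` (word metric). -/
def ballAbout (Y : Set (FreeGroup B)) (R : ℕ) : Set (FreeGroup B) :=
  {g | ∃ y ∈ Y, (y⁻¹ * g).toWord.length ≤ R}

/-- The map `p : (ℤ[F])^k → C¹` of right `ℤ[F]`-modules determined by generators
`f j`, sending `e_j · g` to `f j · g`. -/
noncomputable def pC1 {k : ℕ} (f : Fin k → Boundary B → Boundary B → ℤ)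
    (x : (Fin k × FreeGroup B) →₀ ℤ) : Boundary B → Boundary B → ℤ :=
  fun ξ η => x.sum fun p n => n * f p.1 (actB B p.2 ξ) (actB B p.2 η)

/-- `σ : ∂F → ℤ` is constant on `∂C` for every connected component `C` of `T ∖ X`. -/
def ConstOnComponents (X : Set (FreeGroup B)) (σ : Boundary B → ℤ) : Prop :=
  ∀ C : Set (FreeGroup B), IsComponentOf B X C →
    ∀ ξ, ξ ∈ boundaryOf B C → ∀ η, η ∈ boundaryOf B C → σ ξ = σ η

/-- The shadow `S(g) ⊆ ∂F` of a nontrivial group element `g`: the boundary points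
having the reduced word of `g` as an initial segment. -/
def shadow (g : FreeGroup B) : Set (Boundary B) :=
  {ξ | prefixOf B ξ g.toWord.length = g}

end DecompPaper

namespace DecompPaper

section Words

variable {B : Type} [DecidableEq B]

/-- Right multiplication by a letter either appends that letter to the reduced word or deletes
the last letter. -/
theorem toWord_mul_letter (u : FreeGroup B) (y : B × Bool) :
    (u * FreeGroup.mk [y]).toWord = u.toWord ++ [y] ∨
      u.toWord = (u * FreeGroup.mk [y]).toWord ++ [(y.1, !y.2)] := by
  have hu : u = FreeGroup.mk u.toWord := FreeGroup.mk_toWord.symm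
  have hred : FreeGroup.IsReduced u.toWord := FreeGroup.isReduced_toWord
  rcases List.eq_nil_or_concat u.toWord with h | ⟨l, z, h⟩
  · left
    rw [hu, h, FreeGroup.mul_mk, FreeGroup.toWord_mk]
    simp
  · rw [List.concat_eq_append] at h
    rw [h] at hred
    by_cases hz : z = (y.1, !y.2)
    · right
      have : u * FreeGroup.mk [y] = FreeGroup.mk l := by
        rw [hu, h, FreeGroup.mul_mk, hz]
        apply Quot.sound
        have := FreeGroup.Red.Step.not (L₁ := l) (L₂ := []) (x := y.1) (b := !y.2)
        simpa using this
      rw [this, FreeGroup.toWord_mk,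
        (hred.infix (List.prefix_append l [z]).isInfix).reduce_eq, h, hz]
    · left
      have hy : FreeGroup.IsReduced (l ++ [z] ++ [y]) := by
        refine FreeGroup.IsReduced.append_overlap hred ?_ (by simp)
        simp only [List.singleton_append, FreeGroup.isReduced_cons_cons]
        refine ⟨fun h1 => ?_, FreeGroup.IsReduced.singleton⟩
        by_contra h2
        exact hz (Prod.ext h1 (by cases hz2 : z.2 <;> cases hy2 : y.2 <;> simp_all))
      conv_lhs => rw [hu, h, FreeGroup.mul_mk, FreeGroup.toWord_mk, hy.reduce_eq]
      rw [h]

/-- Right multiplication by an element shorter than `c` does not change the first letter. -/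
theorem head?_toWord_mul (V : List (B × Bool)) (c : FreeGroup B)
    (h : V.length < c.toWord.length) :
    (c * FreeGroup.mk V).toWord.head? = c.toWord.head? := by
  induction V generalizing c with
  | nil => rw [← FreeGroup.one_eq_mk, mul_one]
  | cons y V ih =>
    have hsplit : c * FreeGroup.mk (y :: V) = c * FreeGroup.mk [y] * FreeGroup.mk V := by
      rw [mul_assoc, FreeGroup.mul_mk]; rfl
    rw [List.length_cons] at h
    rw [hsplit]
    rcases toWord_mul_letter c y with hc | hc
    · rw [ih _ (by rw [hc]; simp; omega), hc, List.head?_append_of_ne_nil]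
      intro h0
      simp [h0] at h
    · have hlen := congrArg List.length hc
      simp only [List.length_append, List.length_singleton] at hlen
      rw [ih _ (by omega), hc, List.head?_append_of_ne_nil]
      intro h0
      simp [h0] at hlen
      omega

/-- If `c * v` starts with the letter `x` and `c` does not, then `c` is at most as long as `v`. -/
theorem length_le_of_isPrefix_mul (x : B × Bool) (c v : FreeGroup B)
    (h : ¬ [x] <+: c.toWord) (h' : [x] <+: (c * v).toWord) :
    c.toWord.length ≤ v.toWord.length := by
  by_contra! hlt
  have hh := head?_toWord_mul v.toWord c hlt
  rw [FreeGroup.mk_toWord] at hh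
  rw [List.singleton_prefix_iff_head?_eq_some] at h h'
  exact h (hh ▸ h')

/-- Multiplying on the left by a reduced word not ending in a cancelling letter concatenates. -/
theorem toWord_mk_mul (h : List (B × Bool)) (x : B × Bool)
    (hr : FreeGroup.IsReduced (h ++ [x])) (u : FreeGroup B) (hu : [x] <+: u.toWord) :
    (FreeGroup.mk h * u).toWord = h ++ u.toWord := by
  obtain ⟨t, ht⟩ := hu
  have hu' : FreeGroup.IsReduced u.toWord := FreeGroup.isReduced_toWord
  rw [← ht] at hu'
  have := FreeGroup.IsReduced.append_overlap hr hu' (by simp)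
  conv_lhs => rw [← FreeGroup.mk_toWord (x := u)]
  rw [FreeGroup.mul_mk, FreeGroup.toWord_mk, ← ht, ← List.append_assoc, this.reduce_eq]

theorem toWord_mk_inv_mul (h v : List (B × Bool)) (u : FreeGroup B) (hu : u.toWord = h ++ v) :
    ((FreeGroup.mk h)⁻¹ * u).toWord = v := by
  have hr : FreeGroup.IsReduced u.toWord := FreeGroup.isReduced_toWord
  have : u = FreeGroup.mk h * FreeGroup.mk v := by
    rw [FreeGroup.mul_mk, ← hu, FreeGroup.mk_toWord]
  rw [this, inv_mul_cancel_left, FreeGroup.toWord_mk]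
  rw [hu] at hr
  exact (hr.infix (List.suffix_append h v).isInfix).reduce_eq

end Words

section InitialSegments

variable {B : Type}

/-- The list of the first `m` letters of an infinite reduced word. -/
def initial (ξ : Boundary B) (m : ℕ) : List (B × Bool) :=
  List.ofFn fun i : Fin m => ξ.1 i

@[simp]
theorem length_initial (ξ : Boundary B) (m : ℕ) : (initial ξ m).length = m := by
  simp [initial]

theorem initial_eq_initial_iff {ξ η : Boundary B} {m : ℕ} :
    initial ξ m = initial η m ↔ ∀ i < m, ξ.1 i = η.1 i := by
  rw [initial, initial, List.ofFn_inj, funext_iff, Fin.forall_iff]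

theorem initial_eq_of_le {ξ η : Boundary B} {m n : ℕ} (hmn : m ≤ n)
    (h : initial ξ n = initial η n) : initial ξ m = initial η m := by
  rw [initial_eq_initial_iff] at h ⊢
  exact fun i hi => h i (by omega)

theorem take_initial (ξ : Boundary B) {m n : ℕ} (hmn : m ≤ n) :
    (initial ξ n).take m = initial ξ m := by
  apply List.ext_getElem
  · simp [hmn]
  · intro i h1 h2
    simp [initial]

theorem initial_isPrefix (ξ : Boundary B) {m n : ℕ} (hmn : m ≤ n) :
    initial ξ m <+: initial ξ n := by
  rw [← take_initial ξ hmn]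
  exact List.take_prefix _ _

theorem isReduced_initial (ξ : Boundary B) (m : ℕ) : FreeGroup.IsReduced (initial ξ m) := by
  rw [FreeGroup.IsReduced, List.isChain_iff_getElem]
  intro i hi h1
  have := ξ.2 i
  simp only [initial, List.getElem_ofFn] at h1 ⊢
  by_contra h2
  refine this (Prod.ext h1.symm ?_)
  cases ha : (ξ.1 i).2 <;> cases hb : (ξ.1 (i + 1)).2 <;> simp_all

theorem toWord_prefixOf [DecidableEq B] (ξ : Boundary B) (m : ℕ) :
    (prefixOf B ξ m).toWord = initial ξ m := by
  rw [prefixOf, FreeGroup.toWord_mk]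
  exact (isReduced_initial ξ m).reduce_eq

/-- Deleting the first `n` letters of an infinite reduced word. -/
def strip (n : ℕ) (ξ : Boundary B) : Boundary B :=
  ⟨fun k => ξ.1 (n + k), fun k => ξ.2 (n + k)⟩

theorem initial_add (ξ : Boundary B) (n m : ℕ) :
    initial ξ (n + m) = initial ξ n ++ initial (strip n ξ) m := by
  rw [initial, List.ofFn_add]
  rfl

/-- Every infinite reduced word starting with `x` can be prolonged to the left by `h` as soon as
`h` followed by `x` is reduced. -/
theorem exists_strip_eq (h : List (B × Bool)) (x : B × Bool)
    (hr : FreeGroup.IsReduced (h ++ [x])) (ξ : Boundary B) (hξ : ξ.1 0 = x) :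
    ∃ ζ : Boundary B, initial ζ h.length = h ∧ strip h.length ζ = ξ := by
  have hchain := List.isChain_iff_getElem.1 hr
  refine ⟨⟨fun k => if hk : k < h.length then h[k] else ξ.1 (k - h.length), fun k => ?_⟩, ?_, ?_⟩
  · beta_reduce
    by_cases hk : k < h.length
    · have hc := hchain k (by simp; omega)
      have hnext : (h ++ [x])[k + 1]'(by simp; omega) =
          if hk : k + 1 < h.length then h[k + 1] else ξ.1 (k + 1 - h.length) := by
        split_ifs with hk1
        · rw [List.getElem_append_left hk1]
        · have : k + 1 = h.length := by omega
          rw [List.getElem_append_right (by omega)]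
          simp [this, hξ]
      rw [hnext, List.getElem_append_left hk] at hc
      rw [dif_pos hk]
      intro heq
      rw [heq] at hc
      simp at hc
    · have hk1 : ¬ k + 1 < h.length := by omega
      have := ξ.2 (k - h.length)
      rw [dif_neg hk, dif_neg hk1]
      rwa [show k + 1 - h.length = k - h.length + 1 by omega]
  · apply List.ext_getElem
    · simp
    · intro i h1 h2
      simp [initial]
  · apply Subtype.ext
    funext k
    simp [strip]

theorem eq_of_strip_eq {ξ η : Boundary B} {n : ℕ} (h : initial ξ n = initial η n)
    (hs : strip n ξ = strip n η) : ξ = η := by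
  apply Subtype.ext
  funext k
  by_cases hk : k < n
  · exact initial_eq_initial_iff.1 h k hk
  · have := congrFun (congrArg Subtype.val hs) (k - n)
    simp only [strip] at this
    rwa [show n + (k - n) = k by omega] at this

end InitialSegments

section Lines

variable {B : Type} {r : ℕ}

/-- The infinite reduced words having the list `L` as an initial segment. -/
def cyl (L : List (B × Bool)) : Set (Boundary B) :=
  {ξ | initial ξ L.length = L}

theorem mem_cyl_iff_of_initial_eq {L : List (B × Bool)} {ξ η : Boundary B} {n : ℕ}
    (hn : L.length ≤ n) (h : initial ξ n = initial η n) : ξ ∈ cyl L ↔ η ∈ cyl L := by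
  rw [cyl, Set.mem_ofPred_eq, Set.mem_ofPred_eq, initial_eq_of_le hn h]

theorem mem_cyl_of_isPrefix {L : List (B × Bool)} {ξ : Boundary B} {n : ℕ}
    (h : L <+: initial ξ n) : ξ ∈ cyl L := by
  have hn : L.length ≤ n := by simpa using h.length_le
  rw [List.prefix_iff_eq_take, take_initial ξ hn] at h
  exact h.symm

theorem mem_cyl_singleton {x : B × Bool} {ξ : Boundary B} : ξ ∈ cyl [x] ↔ ξ.1 0 = x := by
  simp [cyl, initial]

theorem mem_cyl_append {h L : List (B × Bool)} {ξ : Boundary B} :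
    ξ ∈ cyl (h ++ L) ↔ ξ ∈ cyl h ∧ strip h.length ξ ∈ cyl L := by
  simp only [cyl, Set.mem_ofPred_eq, List.length_append, initial_add]
  exact ⟨fun H => List.append_inj H (by simp), fun H => by rw [H.1, H.2]⟩

theorem initial_eq_iff_strip {h : List (B × Bool)} {ξ η : Boundary B} (hξ : ξ ∈ cyl h)
    (hη : η ∈ cyl h) (n : ℕ) :
    initial ξ (h.length + n) = initial η (h.length + n) ↔
      initial (strip h.length ξ) n = initial (strip h.length η) n := by
  rw [initial_add, initial_add, show initial ξ h.length = h from hξ,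
    show initial η h.length = h from hη, List.append_cancel_left_eq]

theorem mem_cyl_concat {L : List (B × Bool)} {y : B × Bool} {ξ : Boundary B} :
    ξ ∈ cyl (L ++ [y]) ↔ ξ ∈ cyl L ∧ ξ.1 L.length = y := by
  rw [mem_cyl_append, mem_cyl_singleton]
  rfl

theorem isReduced_of_mem_cyl {L : List (B × Bool)} {ξ : Boundary B} (h : ξ ∈ cyl L) :
    FreeGroup.IsReduced L := by
  have := isReduced_initial ξ L.length
  rwa [show initial ξ L.length = L from h] at this

/-- On the shadow of `L`, the function `f` depends only on the first `n` letters. -/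
def DepOn (L : List (B × Bool)) (n : ℕ) (f : Boundary B → ℤ) : Prop :=
  ∀ ξ ∈ cyl L, ∀ η ∈ cyl L, initial ξ n = initial η n → f ξ = f η

theorem depOn_nil_of_depOn {L : List (B × Bool)} {n : ℕ} {f : Boundary B → ℤ}
    (hn : L.length ≤ n) (h0 : ∀ ξ ∉ cyl L, f ξ = 0) (hdep : DepOn L n f) : DepOn [] n f := by
  intro ξ _ η _ he
  by_cases hξ : ξ ∈ cyl L
  · exact hdep ξ hξ η ((mem_cyl_iff_of_initial_eq hn he).1 hξ) he
  · rw [h0 ξ hξ, h0 η fun hη => hξ ((mem_cyl_iff_of_initial_eq hn he).2 hη)]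

variable [DecidableEq B]

theorem TendstoBoundary.unique {a : ℕ → FreeGroup B} {ξ η : Boundary B}
    (hξ : TendstoBoundary B a ξ) (hη : TendstoBoundary B a η) : ξ = η := by
  apply Subtype.ext
  funext k
  obtain ⟨K, hK⟩ := hξ (k + 1)
  obtain ⟨K', hK'⟩ := hη (k + 1)
  have h1 := List.prefix_iff_eq_take.1 (hK (max K K') (le_max_left _ _))
  have h2 := List.prefix_iff_eq_take.1 (hK' (max K K') (le_max_right _ _))
  rw [List.length_ofFn] at h1 h2
  exact initial_eq_initial_iff.1 (h1.trans h2.symm) k (by omega)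

theorem TendstoBoundary.shift {a b : ℕ → FreeGroup B} {ξ : Boundary B}
    (hξ : TendstoBoundary B a ξ) (n m : ℕ) (h : ∀ k, b (k + n) = a (k + m)) :
    TendstoBoundary B b ξ := by
  intro l
  obtain ⟨K, hK⟩ := hξ l
  refine ⟨K + n, fun k hk => ?_⟩
  have := h (k - n)
  rw [Nat.sub_add_cancel (by omega)] at this
  rw [this]
  exact hK _ (by omega)

theorem TendstoBoundary.strip {a : ℕ → FreeGroup B} {ξ : Boundary B}
    (hξ : TendstoBoundary B a ξ) {h : List (B × Bool)} (hh : ξ ∈ cyl h) :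
    TendstoBoundary B (fun k => (FreeGroup.mk h)⁻¹ * a k) (strip h.length ξ) := by
  intro m
  obtain ⟨K, hK⟩ := hξ (h.length + m)
  refine ⟨K, fun k hk => ?_⟩
  obtain ⟨t, ht⟩ := hK k hk
  change initial ξ (h.length + m) ++ t = _ at ht
  rw [initial_add, show initial ξ h.length = h from hh, List.append_assoc] at ht
  rw [toWord_mk_inv_mul h _ (a k) ht.symm]
  exact List.prefix_append _ _

theorem TendstoBoundary.of_strip {a : ℕ → FreeGroup B} {ξ : Boundary B} {h : List (B × Bool)}
    {x : B × Bool} (hr : FreeGroup.IsReduced (h ++ [x])) (hh : ξ ∈ cyl (h ++ [x]))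
    (hξ : TendstoBoundary B a (DecompPaper.strip h.length ξ)) :
    TendstoBoundary B (fun k => FreeGroup.mk h * a k) ξ := by
  intro m
  obtain ⟨K, hK⟩ := hξ (m + 1)
  refine ⟨K, fun k hk => ?_⟩
  have hp : initial (DecompPaper.strip h.length ξ) (m + 1) <+: (a k).toWord := hK k hk
  obtain ⟨h1, h2⟩ := mem_cyl_append.1 hh
  have hx : [x] <+: (a k).toWord := by
    refine List.IsPrefix.trans ?_ hp
    have := initial_isPrefix (DecompPaper.strip h.length ξ) (show 1 ≤ m + 1 by omega)
    rwa [show initial (DecompPaper.strip h.length ξ) 1 = [x] from h2] at this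
  rw [toWord_mk_mul h x hr _ hx]
  have := initial_isPrefix ξ (show m ≤ h.length + (m + 1) by omega)
  rw [initial_add, show initial ξ h.length = h from h1] at this
  exact this.trans ((List.prefix_append_right_inj h).2 hp)

/-- The words `w i` and their inverses. -/
def symmWords (w : Fin r → FreeGroup B) : Set (FreeGroup B) :=
  Set.range w ∪ Set.range fun i => (w i)⁻¹

theorem isLine_iff {w : Fin r → FreeGroup B} {ξ η : Boundary B} :
    IsLine B w ξ η ↔ ∃ g, ∃ v ∈ symmWords w,
      TendstoBoundary B (fun k => g * v ^ k) ξ ∧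
        TendstoBoundary B (fun k => g * v⁻¹ ^ k) η := by
  constructor
  · rintro ⟨g, i, ⟨h1, h2⟩ | ⟨h1, h2⟩⟩
    · exact ⟨g, w i, Or.inl ⟨i, rfl⟩, h1, h2⟩
    · exact ⟨g, (w i)⁻¹, Or.inr ⟨i, rfl⟩, h2, by rwa [inv_inv]⟩
  · rintro ⟨g, v, ⟨i, rfl⟩ | ⟨i, rfl⟩, h1, h2⟩
    · exact ⟨g, i, Or.inl ⟨h1, h2⟩⟩
    · exact ⟨g, i, Or.inr ⟨by simpa only [inv_inv] using h2, h1⟩⟩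

theorem IsLine.symm {w : Fin r → FreeGroup B} {ξ η : Boundary B} (h : IsLine B w ξ η) :
    IsLine B w η ξ := by
  obtain ⟨g, i, h⟩ := h
  exact ⟨g, i, h.symm⟩

theorem isLine_strip_iff {w : Fin r → FreeGroup B} {ξ η : Boundary B} {h : List (B × Bool)}
    {x : B × Bool} (hr : FreeGroup.IsReduced (h ++ [x])) (hξ : ξ ∈ cyl (h ++ [x]))
    (hη : η ∈ cyl (h ++ [x])) :
    IsLine B w (strip h.length ξ) (strip h.length η) ↔ IsLine B w ξ η := by
  simp only [isLine_iff]
  constructor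
  · rintro ⟨g, v, hv, h1, h2⟩
    refine ⟨FreeGroup.mk h * g, v, hv, ?_, ?_⟩
    · simpa only [mul_assoc] using h1.of_strip hr hξ
    · simpa only [mul_assoc] using h2.of_strip hr hη
  · rintro ⟨g, v, hv, h1, h2⟩
    refine ⟨(FreeGroup.mk h)⁻¹ * g, v, hv, ?_, ?_⟩
    · simpa only [mul_assoc] using h1.strip (mem_cyl_append.1 hξ).1
    · simpa only [mul_assoc] using h2.strip (mem_cyl_append.1 hη).1

/-- The endpoints, in the shadow of the letter `x`, of lines which leave that shadow. -/
def exitPoints (w : Fin r → FreeGroup B) (x : B × Bool) : Set (Boundary B) :=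
  {ξ | ξ ∈ cyl [x] ∧ ∃ a, ∃ v ∈ symmWords w, TendstoBoundary B (fun k => a * v ^ k) ξ ∧
    ∃ k : ℕ, ¬ [x] <+: (a * v⁻¹ ^ k).toWord}

theorem finite_ball [Finite B] (n : ℕ) : {u : FreeGroup B | u.toWord.length ≤ n}.Finite :=
  (List.finite_length_le (B × Bool) n).preimage FreeGroup.toWord_injective.injOn

theorem finite_exitPoints [Finite B] (w : Fin r → FreeGroup B) (x : B × Bool) :
    (exitPoints w x).Finite := by
  have hW : (symmWords w).Finite := (Set.finite_range _).union (Set.finite_range _)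
  have hfin : (⋃ v ∈ symmWords w, ⋃ c ∈ {u : FreeGroup B | u.toWord.length ≤ v.toWord.length},
      {ξ | TendstoBoundary B (fun k => c * v ^ k) ξ}).Finite :=
    hW.biUnion fun v _ => (finite_ball _).biUnion fun c _ =>
      Set.Subsingleton.finite fun _ hξ _ hη => hξ.unique hη
  refine hfin.subset ?_
  rintro ξ ⟨hξ, a, v, hv, hlim, k₁, hk₁⟩
  set b := a * v⁻¹ ^ k₁ with hb
  have hb' : TendstoBoundary B (fun k => b * v ^ k) ξ := by
    refine hlim.shift k₁ 0 fun k => ?_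
    rw [hb, mul_assoc, inv_pow, add_comm, pow_add, inv_mul_cancel_left, add_zero]
  obtain ⟨K, hK⟩ := hb' 1
  have hP : ∃ k, [x] <+: (b * v ^ k).toWord := by
    refine ⟨K, ?_⟩
    have := hK K le_rfl
    change initial ξ 1 <+: _ at this
    rwa [show initial ξ 1 = [x] from hξ] at this
  classical
  obtain ⟨j, hj⟩ : ∃ j, Nat.find hP = j + 1 := by
    refine Nat.exists_eq_succ_of_ne_zero fun h0 => hk₁ ?_
    have := Nat.find_spec hP
    rwa [h0, pow_zero, mul_one] at this
  have h1 : ¬ [x] <+: (b * v ^ j).toWord := Nat.find_min hP (by omega)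
  have h2 : [x] <+: (b * v ^ j * v).toWord := by
    have := Nat.find_spec hP
    rwa [hj, pow_succ, ← mul_assoc] at this
  simp only [Set.mem_iUnion]
  refine ⟨v, hv, b * v ^ j, length_le_of_isPrefix_mul x _ _ h1 h2, ?_⟩
  refine hb'.shift 0 j fun k => ?_
  rw [add_zero, mul_assoc, ← pow_add, add_comm]

/-- A line leaving the shadow of a word `h x` exits, after translation, the shadow of `x`. -/
theorem strip_mem_exitPoints {w : Fin r → FreeGroup B} {ξ η : Boundary B} {h : List (B × Bool)}
    {x : B × Bool} (hr : FreeGroup.IsReduced (h ++ [x])) (hξ : ξ ∈ cyl (h ++ [x]))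
    (hη : η ∉ cyl (h ++ [x])) (hl : IsLine B w ξ η) : strip h.length ξ ∈ exitPoints w x := by
  obtain ⟨g, v, hv, h1, h2⟩ := isLine_iff.1 hl
  refine ⟨(mem_cyl_append.1 hξ).2, (FreeGroup.mk h)⁻¹ * g, v, hv, ?_, ?_⟩
  · simpa only [mul_assoc] using h1.strip (mem_cyl_append.1 hξ).1
  · obtain ⟨K, hK⟩ := h2 (h ++ [x]).length
    refine ⟨K, fun hx => hη ?_⟩
    have h3 := toWord_mk_mul h x hr _ hx
    rw [mul_assoc, mul_inv_cancel_left] at h3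
    have h4 : initial η (h ++ [x]).length <+: (g * v⁻¹ ^ K).toWord := hK K le_rfl
    refine mem_cyl_of_isPrefix (n := (h ++ [x]).length) ?_
    refine List.prefix_of_prefix_length_le ?_ h4 (by simp)
    rw [h3]
    exact (List.prefix_append_right_inj h).2 (by rwa [mul_assoc] at hx)

/-- `f` takes equal values at the endpoints of every line contained in the shadow of `L`. -/
def InvOn (w : Fin r → FreeGroup B) (L : List (B × Bool)) (f : Boundary B → ℤ) : Prop :=
  ∀ ξ ∈ cyl L, ∀ η ∈ cyl L, IsLine B w ξ η → f ξ = f η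

/-- The restrictions to the exit points of the functions on the shadow of `x` which are invariant
under lines and depend only on the first `n` letters. -/
def restrictions (w : Fin r → FreeGroup B) (x : B × Bool) (n : ℕ) :
    Submodule ℤ (exitPoints w x → ℤ) where
  carrier := {φ | ∃ f, InvOn w [x] f ∧ DepOn [x] n f ∧ ∀ ξ, φ ξ = f ξ.1}
  zero_mem' := ⟨0, fun _ _ _ _ _ => rfl, fun _ _ _ _ _ => rfl, fun _ => rfl⟩
  add_mem' := by
    rintro _ _ ⟨f, h1, h2, h3⟩ ⟨f', h1', h2', h3'⟩
    refine ⟨f + f', fun ξ hξ η hη hl => ?_, fun ξ hξ η hη hl => ?_, fun ξ => ?_⟩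
    · simp only [Pi.add_apply, h1 ξ hξ η hη hl, h1' ξ hξ η hη hl]
    · simp only [Pi.add_apply, h2 ξ hξ η hη hl, h2' ξ hξ η hη hl]
    · simp only [Pi.add_apply, h3, h3']
  smul_mem' := by
    rintro c _ ⟨f, h1, h2, h3⟩
    refine ⟨c • f, fun ξ hξ η hη hl => ?_, fun ξ hξ η hη hl => ?_, fun ξ => ?_⟩
    · simp only [Pi.smul_apply, h1 ξ hξ η hη hl]
    · simp only [Pi.smul_apply, h2 ξ hξ η hη hl]
    · simp only [Pi.smul_apply, h3]

theorem restrictions_mono (w : Fin r → FreeGroup B) (x : B × Bool) :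
    Monotone (restrictions w x) := by
  rintro m n hmn φ ⟨f, h1, h2, h3⟩
  exact ⟨f, h1, fun ξ hξ η hη he => h2 ξ hξ η hη (initial_eq_of_le hmn he), h3⟩

theorem exists_restrictions_le [Finite B] (w : Fin r → FreeGroup B) :
    ∃ M, 0 < M ∧ ∀ x n, restrictions w x n ≤ restrictions w x M := by
  have key : ∀ x, ∃ M, ∀ n, restrictions w x n ≤ restrictions w x M := by
    intro x
    have := (finite_exitPoints w x).to_subtype
    obtain ⟨M, hM⟩ := monotone_stabilizes_iff_noetherian.2
      (inferInstance : IsNoetherian ℤ (exitPoints w x → ℤ)) ⟨_, restrictions_mono w x⟩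
    refine ⟨M, fun n => ?_⟩
    rcases le_total n M with h | h
    · exact restrictions_mono w x h
    · exact (hM n h).ge
  choose M hM using key
  obtain ⟨N, hN⟩ := (Set.finite_range M).bddAbove
  exact ⟨N + 1, N.succ_pos, fun x n =>
    (hM x n).trans (restrictions_mono w x ((hN ⟨x, rfl⟩).trans N.le_succ))⟩

/-- A function on the shadow of `h x` can be replaced by one of uniformly bounded depth without
changing its values at the endpoints of lines leaving the shadow. -/
theorem exists_bounded_depth [Finite B] (w : Fin r → FreeGroup B) :
    ∃ M, 0 < M ∧ ∀ (h : List (B × Bool)) (x : B × Bool), FreeGroup.IsReduced (h ++ [x]) →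
      ∀ (n : ℕ) (f : Boundary B → ℤ), InvOn w (h ++ [x]) f → DepOn (h ++ [x]) (h.length + n) f →
        ∃ f' : Boundary B → ℤ, InvOn w (h ++ [x]) f' ∧ DepOn (h ++ [x]) (h.length + M) f' ∧
          ∀ ξ ∈ cyl (h ++ [x]), ∀ η ∉ cyl (h ++ [x]), IsLine B w ξ η → f' ξ = f ξ := by
  obtain ⟨M, hpos, hM⟩ := exists_restrictions_le w
  refine ⟨M, hpos, fun h x hr n f hinv hdep => ?_⟩
  have hp : ∀ ξ : Boundary B, ∃ ζ : Boundary B, ξ ∈ cyl [x] →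
      ζ ∈ cyl (h ++ [x]) ∧ strip h.length ζ = ξ := by
    intro ξ
    by_cases hξ : ξ ∈ cyl [x]
    · obtain ⟨ζ, h1, h2⟩ := exists_strip_eq h x hr ξ (mem_cyl_singleton.1 hξ)
      exact ⟨ζ, fun _ => ⟨mem_cyl_append.2 ⟨h1, h2.symm ▸ hξ⟩, h2⟩⟩
    · exact ⟨ξ, fun h' => absurd h' hξ⟩
  choose p hp using hp
  obtain ⟨f', h1, h2, h3⟩ : (fun ξ : exitPoints w x => f (p ξ)) ∈ restrictions w x M := by
    refine hM x n ⟨fun ξ => f (p ξ), fun ξ hξ η hη hl => ?_, fun ξ hξ η hη he => ?_, fun _ => rfl⟩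
    · refine hinv _ (hp ξ hξ).1 _ (hp η hη).1 ?_
      rwa [← isLine_strip_iff hr (hp ξ hξ).1 (hp η hη).1, (hp ξ hξ).2, (hp η hη).2]
    · refine hdep _ (hp ξ hξ).1 _ (hp η hη).1 ?_
      rwa [initial_eq_iff_strip (mem_cyl_append.1 (hp ξ hξ).1).1
        (mem_cyl_append.1 (hp η hη).1).1, (hp ξ hξ).2, (hp η hη).2]
  refine ⟨fun ξ => f' (strip h.length ξ), fun ξ hξ η hη hl => ?_, fun ξ hξ η hη he => ?_,
    fun ξ hξ η hη hl => ?_⟩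
  · exact h1 _ (mem_cyl_append.1 hξ).2 _ (mem_cyl_append.1 hη).2 ((isLine_strip_iff hr hξ hη).2 hl)
  · refine h2 _ (mem_cyl_append.1 hξ).2 _ (mem_cyl_append.1 hη).2 ?_
    rwa [← initial_eq_iff_strip (mem_cyl_append.1 hξ).1 (mem_cyl_append.1 hη).1]
  · have hs := hp _ (mem_cyl_append.1 hξ).2
    have hpξ : p (strip h.length ξ) = ξ := by
      refine eq_of_strip_eq ?_ hs.2
      rw [show initial ξ h.length = h from (mem_cyl_append.1 hξ).1,
        show initial (p _) h.length = h from (mem_cyl_append.1 hs.1).1]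
    have := h3 ⟨_, strip_mem_exitPoints hr hξ hη hl⟩
    simp only [hpξ] at this
    exact this.symm

end Lines

section Support

variable {B : Type}

theorem Adj.symm {u v : FreeGroup B} (h : Adj B u v) : Adj B v u := by
  obtain ⟨x, rfl⟩ := h
  refine ⟨(x.1, !x.2), ?_⟩
  have : FreeGroup.mk [(x.1, !x.2)] = (FreeGroup.mk [x])⁻¹ := by
    simp [FreeGroup.inv_mk, FreeGroup.invRev]
  rw [this, mul_inv_cancel_right]

variable [DecidableEq B]

/-- The ball of radius `M` about the vertex `g` of the Cayley tree. -/
def ballAt (g : FreeGroup B) (M : ℕ) : Set (FreeGroup B) :=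
  (fun u => g * u) '' {u | u.toWord.length ≤ M}

theorem mem_ballAt {g v : FreeGroup B} {M : ℕ} :
    v ∈ ballAt g M ↔ (g⁻¹ * v).toWord.length ≤ M := by
  constructor
  · rintro ⟨u, hu, rfl⟩
    simpa using hu
  · exact fun h => ⟨g⁻¹ * v, h, by simp⟩

theorem finite_ballAt [Finite B] (g : FreeGroup B) (M : ℕ) : (ballAt g M).Finite :=
  (finite_ball M).image _

theorem self_mem_ballAt (g : FreeGroup B) (M : ℕ) : g ∈ ballAt g M := by
  simp [mem_ballAt]

theorem ncard_ballAt_le [Finite B] (g : FreeGroup B) (M : ℕ) :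
    (ballAt g M).ncard ≤ {u : FreeGroup B | u.toWord.length ≤ M}.ncard :=
  Set.ncard_image_le (finite_ball M)

theorem isSubtree_ballAt (g : FreeGroup B) (M : ℕ) : IsSubtree B (ballAt g M) := by
  have hmem : ∀ L : List (B × Bool), L.length ≤ M → g * FreeGroup.mk L ∈ ballAt g M := by
    intro L hL
    rw [mem_ballAt, inv_mul_cancel_left]
    exact FreeGroup.norm_mk_le.trans hL
  have hstep : ∀ (L : List (B × Bool)) (x : B × Bool),
      Adj B (g * FreeGroup.mk L) (g * FreeGroup.mk (L ++ [x])) := fun L x =>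
    ⟨x, by rw [mul_assoc, FreeGroup.mul_mk]⟩
  have key : ∀ L : List (B × Bool), L.length ≤ M →
      Relation.ReflTransGen (fun a b => Adj B a b ∧ b ∈ ballAt g M) g (g * FreeGroup.mk L) ∧
      Relation.ReflTransGen (fun a b => Adj B a b ∧ b ∈ ballAt g M) (g * FreeGroup.mk L) g := by
    intro L
    induction L using List.reverseRecOn with
    | nil =>
      intro _
      rw [← FreeGroup.one_eq_mk, mul_one]
      exact ⟨.refl, .refl⟩
    | append_singleton L x ih =>
      intro hL
      have hL' : L.length ≤ M := by
        rw [List.length_append] at hL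
        omega
      exact ⟨(ih hL').1.tail ⟨hstep L x, hmem _ hL⟩,
        (ih hL').2.head ⟨(hstep L x).symm, hmem _ hL'⟩⟩
  rintro _ ⟨u, hu, rfl⟩ _ ⟨v, hv, rfl⟩
  have h1 := (key u.toWord hu).2
  have h2 := (key v.toWord hv).1
  rw [FreeGroup.mk_toWord] at h1 h2
  exact h1.trans h2

/-- Leaving the ball of radius `M` about `L`, adjacent vertices below `L` share their first
`L.length + M` letters. -/
theorem take_eq_of_adj {L : List (B × Bool)} {M : ℕ} {u v : FreeGroup B} (hadj : Adj B u v)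
    (hu : u ∉ ballAt (FreeGroup.mk L) M) (hL : L <+: u.toWord) :
    L <+: v.toWord ∧ v.toWord.take (L.length + M) = u.toWord.take (L.length + M) := by
  obtain ⟨y, rfl⟩ := hadj
  obtain ⟨t, ht⟩ := hL
  have hlen : L.length + M < u.toWord.length := by
    rw [mem_ballAt, toWord_mk_inv_mul L t u ht.symm] at hu
    rw [← ht, List.length_append]
    omega
  have hpre : L <+: u.toWord := ⟨t, ht⟩
  rcases toWord_mul_letter u y with h | h
  · rw [h]
    exact ⟨hpre.trans (List.prefix_append _ _), List.take_append_of_le_length hlen.le⟩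
  · have hlen' : u.toWord.length = (u * FreeGroup.mk [y]).toWord.length + 1 := by
      conv_lhs => rw [h]
      simp
    refine ⟨List.prefix_of_prefix_length_le hpre (h ▸ List.prefix_append _ _) (by omega), ?_⟩
    conv_rhs => rw [h]
    rw [List.take_append_of_le_length (by omega)]

theorem take_eq_of_isComponentOf {L : List (B × Bool)} {M : ℕ} {C : Set (FreeGroup B)}
    (hC : IsComponentOf B (ballAt (FreeGroup.mk L) M) C) {u v : FreeGroup B} (hu : u ∈ C)
    (hv : v ∈ C) (hL : L <+: u.toWord) :
    L <+: v.toWord ∧ v.toWord.take (L.length + M) = u.toWord.take (L.length + M) := by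
  obtain ⟨c, -, rfl⟩ := hC
  have hsymm : Std.Symm (fun a b : FreeGroup B => Adj B a b ∧
      a ∉ ballAt (FreeGroup.mk L) M ∧ b ∉ ballAt (FreeGroup.mk L) M) :=
    ⟨fun a b h => ⟨h.1.symm, h.2.2, h.2.1⟩⟩
  have huv := (Relation.ReflTransGen.stdSymm.symm _ _ hu).trans hv
  clear hv
  induction huv with
  | refl => exact ⟨hL, rfl⟩
  | tail _ hbc ih =>
    obtain ⟨h1, h2⟩ := ih
    obtain ⟨h3, h4⟩ := take_eq_of_adj hbc.1 hbc.2.1 h1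
    exact ⟨h3, h4.trans h2⟩

/-- A function vanishing outside the shadow of `L` and depending there on the first `L.length + M`
letters is supported on the ball of radius `M` about `L`. -/
theorem constOnComponents_ballAt {L : List (B × Bool)} {M : ℕ} {f : Boundary B → ℤ}
    (h0 : ∀ ξ ∉ cyl L, f ξ = 0) (hdep : DepOn L (L.length + M) f) :
    ConstOnComponents B (ballAt (FreeGroup.mk L) M) f := by
  intro C hC
  have key : ∀ ξ ∈ boundaryOf B C, ∀ η ∈ boundaryOf B C, ξ ∈ cyl L →
      η ∈ cyl L ∧ f ξ = f η := by
    rintro ξ ⟨m, hm⟩ η ⟨m', hm'⟩ hξ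
    have hlarge : ∃ k, m ≤ k ∧ m' ≤ k ∧ L.length + M ≤ k :=
      ⟨m + m' + (L.length + M), by omega, by omega, by omega⟩
    obtain ⟨k, hk, hk', hkL⟩ := hlarge
    have hpre : L <+: (prefixOf B ξ k).toWord := by
      rw [toWord_prefixOf]
      have := initial_isPrefix ξ (show L.length ≤ k by omega)
      rwa [show initial ξ L.length = L from hξ] at this
    obtain ⟨h1, h2⟩ := take_eq_of_isComponentOf hC (hm k hk) (hm' k hk') hpre
    rw [toWord_prefixOf] at h1 h2
    rw [toWord_prefixOf, take_initial _ hkL, take_initial _ hkL] at h2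
    have hη := mem_cyl_of_isPrefix h1
    exact ⟨hη, hdep ξ hξ η hη h2.symm⟩
  intro ξ hξ η hη
  by_cases h1 : ξ ∈ cyl L
  · exact (key ξ hξ η hη h1).2
  · by_cases h2 : η ∈ cyl L
    · exact absurd (key η hη ξ hξ h2).1 h1
    · rw [h0 ξ h1, h0 η h2]

end Support

section Topology

variable {B : Type}

instance : DiscreteTopology (B × Bool) := ⟨rfl⟩

theorem isOpen_initial_eq (ξ : Boundary B) (n : ℕ) :
    IsOpen {η : Boundary B | initial η n = initial ξ n} := by
  have : {η : Boundary B | initial η n = initial ξ n} =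
      Subtype.val ⁻¹' PiNat.cylinder (E := fun _ => B × Bool) ξ.1 n := by
    ext η
    simp only [Set.mem_preimage, PiNat.mem_cylinder_iff]
    exact initial_eq_initial_iff
  rw [this]
  exact (PiNat.isOpen_cylinder _ ξ.1 n).preimage continuous_subtype_val

theorem continuous_of_depOn_nil {n : ℕ} {f : Boundary B → ℤ} (hf : DepOn [] n f) :
    Continuous f := by
  refine IsLocallyConstant.continuous ((IsLocallyConstant.iff_exists_open f).2 fun ξ => ?_)
  exact ⟨_, isOpen_initial_eq ξ n, rfl, fun η hη => hf η rfl ξ rfl hη⟩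

theorem compactSpace_boundary [Finite B] : CompactSpace (Boundary B) := by
  have : IsClosed {s : ℕ → B × Bool | ∀ k, s (k + 1) ≠ ((s k).1, !(s k).2)} := by
    simp only [Set.ofPred_forall]
    refine isClosed_iInter fun k => ?_
    exact (isClosed_discrete {p : (B × Bool) × (B × Bool) | p.2 ≠ (p.1.1, !p.1.2)}).preimage
      (f := fun s : ℕ → B × Bool => (s k, s (k + 1))) (by fun_prop)
  exact isCompact_iff_compactSpace.1 this.isCompact

theorem exists_depOn_nil_of_continuous [Finite B] {f : Boundary B → ℤ} (hf : Continuous f) :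
    ∃ n, DepOn [] n f := by
  have := compactSpace_boundary (B := B)
  have hmono : Monotone fun n => {ξ : Boundary B | ∀ η, initial η n = initial ξ n → f η = f ξ} :=
    fun m n hmn ξ hξ η hη => hξ η (initial_eq_of_le hmn hη)
  have hopen : ∀ n, IsOpen {ξ : Boundary B | ∀ η, initial η n = initial ξ n → f η = f ξ} := by
    intro n
    rw [isOpen_iff_forall_mem_open]
    intro ξ hξ
    refine ⟨_, fun ζ hζ η hη => ?_, isOpen_initial_eq ξ n, rfl⟩
    rw [hξ η (hη.trans hζ), hξ ζ hζ]
  have hcover : Set.univ ⊆ ⋃ n, {ξ : Boundary B | ∀ η, initial η n = initial ξ n → f η = f ξ} := by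
    intro ξ _
    obtain ⟨U, hU, hU'⟩ := isOpen_induced_iff.1 ((isOpen_discrete {f ξ}).preimage hf)
    have hξU : ξ.1 ∈ U := by
      have : ξ ∈ Subtype.val ⁻¹' U := by rw [hU']; rfl
      exact this
    obtain ⟨_, ⟨x, n, rfl⟩, hx, hsub⟩ :=
      (PiNat.isTopologicalBasis_cylinders (fun _ => B × Bool)).exists_subset_of_mem_open hξU hU
    refine Set.mem_iUnion.2 ⟨n, fun η hη => ?_⟩
    have hηU : η ∈ Subtype.val ⁻¹' U := by
      refine hsub (PiNat.mem_cylinder_iff.2 fun i hi => ?_)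
      rw [initial_eq_initial_iff.1 hη i hi]
      exact PiNat.mem_cylinder_iff.1 hx i hi
    rw [hU'] at hηU
    exact hηU
  obtain ⟨n, hn⟩ := isCompact_univ.elim_directed_cover _ hopen hcover hmono.directed_le
  exact ⟨n, fun ξ _ η _ he => hn (Set.mem_univ η) ξ he⟩

end Topology

section Generation

variable {B : Type} [DecidableEq B] {r : ℕ}

/-- The locally constant functions on the boundary that are invariant under the line pattern and
supported on a finite subtree with at most `N` vertices. -/
def generators (w : Fin r → FreeGroup B) (N : ℕ) : Set (Boundary B → ℤ) :=
  {f | InvOn w [] f ∧ (∃ n, DepOn [] n f) ∧ ∃ X : Set (FreeGroup B), X.Finite ∧ X.Nonempty ∧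
    IsSubtree B X ∧ X.ncard ≤ N ∧ ConstOnComponents B X f}

theorem mem_generators_of_depOn [Finite B] {w : Fin r → FreeGroup B} {L : List (B × Bool)} {M : ℕ}
    {f : Boundary B → ℤ} (hinv : InvOn w [] f) (h0 : ∀ ξ ∉ cyl L, f ξ = 0)
    (hdep : DepOn L (L.length + M) f) :
    f ∈ generators w {u : FreeGroup B | u.toWord.length ≤ M}.ncard :=
  ⟨hinv, ⟨_, depOn_nil_of_depOn (by omega) h0 hdep⟩, ballAt (FreeGroup.mk L) M,
    finite_ballAt _ _, ⟨_, self_mem_ballAt _ _⟩, isSubtree_ballAt _ _, ncard_ballAt_le _ _,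
    constOnComponents_ballAt h0 hdep⟩

/-- Functions invariant under the line pattern are generated by those of bounded support. -/
theorem exists_mem_span_generators [Finite B] (w : Fin r → FreeGroup B) :
    ∃ N, ∀ (n : ℕ) (f : Boundary B → ℤ), InvOn w [] f → DepOn [] n f →
      f ∈ Submodule.span ℤ (generators w N) := by
  have : Fintype B := Fintype.ofFinite B
  obtain ⟨M, hpos, hM⟩ := exists_bounded_depth w
  refine ⟨{u : FreeGroup B | u.toWord.length ≤ M}.ncard, ?_⟩
  suffices H : ∀ (n : ℕ) (L : List (B × Bool)) (f : Boundary B → ℤ), InvOn w [] f →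
      (∀ ξ ∉ cyl L, f ξ = 0) → DepOn L (L.length + n) f →
        f ∈ Submodule.span ℤ
          (generators w {u : FreeGroup B | u.toWord.length ≤ M}.ncard) by
    refine fun n f hinv hdep => H n [] f hinv (fun ξ hξ => absurd rfl hξ) ?_
    simpa using hdep
  intro n
  induction n with
  | zero =>
    intro L f hinv h0 hdep
    refine Submodule.subset_span (mem_generators_of_depOn hinv h0 fun ξ hξ η hη he => ?_)
    exact hdep ξ hξ η hη (initial_eq_of_le (by omega) he)
  | succ n ih =>
    intro L f hinv h0 hdep
    by_cases hn : n + 1 ≤ M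
    · refine Submodule.subset_span (mem_generators_of_depOn hinv h0 fun ξ hξ η hη he => ?_)
      exact hdep ξ hξ η hη (initial_eq_of_le (by omega) he)
    have hcyl : ∀ {y ξ}, ξ ∈ cyl (L ++ [y]) → ξ ∈ cyl L := fun h => (mem_cyl_concat.1 h).1
    have happrox : ∀ y : B × Bool, ∃ f' : Boundary B → ℤ, InvOn w (L ++ [y]) f' ∧
        DepOn (L ++ [y]) (L.length + M) f' ∧
        ∀ ξ ∈ cyl (L ++ [y]), ∀ η ∉ cyl (L ++ [y]), IsLine B w ξ η → f' ξ = f ξ := by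
      intro y
      by_cases hr : FreeGroup.IsReduced (L ++ [y])
      · exact hM L y hr (n + 1) f (fun ξ _ η _ hl => hinv ξ rfl η rfl hl)
          fun ξ hξ η hη he => hdep ξ (hcyl hξ) η (hcyl hη) he
      · exact ⟨0, fun _ _ _ _ _ => rfl, fun _ _ _ _ _ => rfl,
          fun ξ hξ => absurd (isReduced_of_mem_cyl hξ) hr⟩
    choose a hainv hadep haf using happrox
    classical
    set τ : Boundary B → ℤ := fun ξ => if ξ ∈ cyl L then a (ξ.1 L.length) ξ else 0 with hτ
    have hτ0 : ∀ ξ ∉ cyl L, τ ξ = 0 := fun ξ hξ => if_neg hξ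
    have hτa : ∀ {y ξ}, ξ ∈ cyl (L ++ [y]) → τ ξ = a y ξ := by
      intro y ξ hξ
      obtain ⟨h1, h2⟩ := mem_cyl_concat.1 hξ
      simp only [hτ, if_pos h1, h2]
    have hτexit : ∀ {y ξ η}, ξ ∈ cyl (L ++ [y]) → η ∉ cyl (L ++ [y]) → IsLine B w ξ η →
        τ ξ = f ξ := fun hξ hη hl => (hτa hξ).trans (haf _ _ hξ _ hη hl)
    have hτL : ∀ ξ η, ξ ∈ cyl L → IsLine B w ξ η → τ ξ = τ η := by
      intro ξ η hξ hl
      have hξ' : ξ ∈ cyl (L ++ [ξ.1 L.length]) := mem_cyl_concat.2 ⟨hξ, rfl⟩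
      by_cases hη : η ∈ cyl (L ++ [ξ.1 L.length])
      · rw [hτa hξ', hτa hη, hainv _ ξ hξ' η hη hl]
      · rw [hτexit hξ' hη hl, hinv ξ rfl η rfl hl]
        by_cases hη' : η ∈ cyl L
        · have hη'' : η ∈ cyl (L ++ [η.1 L.length]) := mem_cyl_concat.2 ⟨hη', rfl⟩
          refine (hτexit hη'' (fun h => hη ?_) hl.symm).symm
          rw [(mem_cyl_concat.1 h).2]
          exact hη''
        · rw [h0 η hη', hτ0 η hη']
    have hτinv : InvOn w [] τ := by
      intro ξ _ η _ hl
      by_cases hξ : ξ ∈ cyl L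
      · exact hτL ξ η hξ hl
      · by_cases hη : η ∈ cyl L
        · exact (hτL η ξ hη hl.symm).symm
        · rw [hτ0 ξ hξ, hτ0 η hη]
    have hτspan : τ ∈ Submodule.span ℤ
        (generators w {u : FreeGroup B | u.toWord.length ≤ M}.ncard) := by
      refine Submodule.subset_span (mem_generators_of_depOn hτinv hτ0 fun ξ hξ η hη he => ?_)
      have hlast : ξ.1 L.length = η.1 L.length :=
        initial_eq_initial_iff.1 he L.length (by omega)
      have hξ' : ξ ∈ cyl (L ++ [η.1 L.length]) := mem_cyl_concat.2 ⟨hξ, hlast⟩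
      have hη' : η ∈ cyl (L ++ [η.1 L.length]) := mem_cyl_concat.2 ⟨hη, rfl⟩
      rw [hτa hξ', hτa hη', hadep _ ξ hξ' η hη' he]
    have hsum : f = τ + ∑ y : B × Bool, (cyl (L ++ [y])).indicator (f - τ) := by
      funext ξ
      rw [Pi.add_apply, Finset.sum_apply]
      by_cases hξ : ξ ∈ cyl L
      · rw [Finset.sum_eq_single (ξ.1 L.length), Set.indicator_of_mem, Pi.sub_apply,
          add_sub_cancel]
        · exact mem_cyl_concat.2 ⟨hξ, rfl⟩
        · intro y _ hy
          exact Set.indicator_of_notMem (fun h => hy (mem_cyl_concat.1 h).2.symm) _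
        · simp
      · rw [Finset.sum_eq_zero fun y _ => Set.indicator_of_notMem (fun h => hξ (hcyl h)) _,
          h0 ξ hξ, hτ0 ξ hξ, add_zero]
    rw [hsum]
    refine add_mem hτspan (sum_mem fun y _ => ih (L ++ [y]) _ ?_ ?_ ?_)
    · have hexit : ∀ ξ η, ξ ∈ cyl (L ++ [y]) → η ∉ cyl (L ++ [y]) → IsLine B w ξ η →
          (f - τ) ξ = 0 := fun ξ η hξ hη hl => by
        rw [Pi.sub_apply, hτexit hξ hη hl, sub_self]
      intro ξ _ η _ hl
      by_cases hξ : ξ ∈ cyl (L ++ [y]) <;> by_cases hη : η ∈ cyl (L ++ [y])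
      · rw [Set.indicator_of_mem hξ, Set.indicator_of_mem hη, Pi.sub_apply, Pi.sub_apply,
          hinv ξ rfl η rfl hl, hτinv ξ rfl η rfl hl]
      · rw [Set.indicator_of_mem hξ, Set.indicator_of_notMem hη, hexit ξ η hξ hη hl]
      · rw [Set.indicator_of_notMem hξ, Set.indicator_of_mem hη, hexit η ξ hη hξ hl.symm]
      · rw [Set.indicator_of_notMem hξ, Set.indicator_of_notMem hη]
    · exact fun ξ hξ => Set.indicator_of_notMem hξ _
    · intro ξ hξ η hη he
      have hlen : (L ++ [y]).length + n = L.length + (n + 1) := by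
        rw [List.length_append, List.length_singleton]
        omega
      rw [hlen] at he
      rw [Set.indicator_of_mem hξ, Set.indicator_of_mem hη, Pi.sub_apply, Pi.sub_apply,
        hdep ξ (hcyl hξ) η (hcyl hη) he, hτa hξ, hτa hη,
        hadep y ξ hξ η hη (initial_eq_of_le (by omega) he)]

end Generation

end DecompPaper

open DecompPaper
/-- Theorem `generators0`: there is `N`, depending only on `B` and
the words `w i`, such that every continuous `σ : D → ℤ` is a finite `ℤ`-linear
combination of continuous functions each supported on a finite nonempty subtree of `T`
with at most `N` vertices. -/
theorem zeroth_cohomology_generated_by_bounded_support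
    (B : Type) [Fintype B] [DecidableEq B] (hB : 2 ≤ Fintype.card B)
    (r : ℕ) (w : Fin r → FreeGroup B) (hw : ∀ i, w i ≠ 1) (hmal : Malnormal B w) :
    ∃ N : ℕ, ∀ σ : DSpace B w → ℤ, Continuous σ →
      ∃ (m : ℕ) (c : Fin m → ℤ) (τ : Fin m → DSpace B w → ℤ),
        (∀ i, Continuous (τ i)) ∧
        (∀ i, ∃ X : Set (FreeGroup B), X.Finite ∧ X.Nonempty ∧ IsSubtree B X ∧
          X.ncard ≤ N ∧ SupportedOn B w (τ i) X) ∧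
        σ = fun d => ∑ i, c i * τ i d := by
  obtain ⟨N, hN⟩ := exists_mem_span_generators w
  refine ⟨N, fun σ hσ => ?_⟩
  have hinv : InvOn w [] (σ ∘ qmap B w) := fun ξ _ η _ hl => congrArg σ (Quot.sound hl)
  obtain ⟨n, hn⟩ := exists_depOn_nil_of_continuous (hσ.comp continuous_quot_mk)
  obtain ⟨m, c, τ, hτ⟩ := Submodule.mem_span_set'.1 (hN n _ hinv hn)
  refine ⟨m, c, fun i => Quot.lift (τ i).1 fun ξ η hl => (τ i).2.1 ξ rfl η rfl hl,
    fun i => ?_, fun i => (τ i).2.2.2, ?_⟩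
  · obtain ⟨k, hk⟩ := (τ i).2.2.1
    exact continuous_quot_lift _ (continuous_of_depOn_nil hk)
  · funext d
    induction d using Quot.ind with
    | mk ξ => simpa [qmap] using (congrFun hτ ξ).symm
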